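/- With T and R as given, for every term u : T one has Relation.TransGen R (f(u,u)) (f(g(u), g(u))) (in two steps: f(u,u) R f(g(u), h(u)) R f(g(u), g(u))), and consequently for every u : T the term f(u,u) is non-terminating with respect to R: there exists gseq : ℕ → T with gseq 0 = f(u,u) and Relation.TransGen R (gseq n) (gseq (n+1)) for all n : ℕ. -/

import Mathlib

/-- Ground terms over the signature f (binary), g (unary), h (unary), constant c. -/
inductive T : Type
  | f : T → T → T
  | g : T → T
  | h : T → T
  | c : T

/-- One-step rewrite relation of the TRS { f(x,x) → f(g(x), h(x)),  h(x) → g(x) },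
    closed under contexts. -/
inductive R : T → T → Prop
  | rule1 (x : T) : R (T.f x x) (T.f (T.g x) (T.h x))
  | rule2 (x : T) : R (T.h x) (T.g x)
  | ctx_g {u u' : T} : R u u' → R (T.g u) (T.g u')
  | ctx_h {u u' : T} : R u u' → R (T.h u) (T.h u')
  | ctx_f1 {u u' : T} (v : T) : R u u' → R (T.f u v) (T.f u' v)
  | ctx_f2 {u u' : T} (v : T) : R u u' → R (T.f v u) (T.f v u')

theorem R.transGen_f_self (u : T) : Relation.TransGen R (T.f u u) (T.f (T.g u) (T.g u)) :=
  .tail (.single (.rule1 u)) (.ctx_f2 _ (.rule2 u))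

theorem fxx_loops_and_nonterminating :
    (∀ u : T, R (T.f u u) (T.f (T.g u) (T.h u)) ∧
      R (T.f (T.g u) (T.h u)) (T.f (T.g u) (T.g u)) ∧
      Relation.TransGen R (T.f u u) (T.f (T.g u) (T.g u))) ∧
    ∀ u : T, ∃ gseq : ℕ → T, gseq 0 = T.f u u ∧
      ∀ n : ℕ, Relation.TransGen R (gseq n) (gseq (n + 1)) := by
  refine ⟨fun u => ⟨.rule1 u, .ctx_f2 _ (.rule2 u), R.transGen_f_self u⟩, fun u => ?_⟩
  refine ⟨fun n => T.f (T.g^[n] u) (T.g^[n] u), rfl, fun n => ?_⟩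
  simpa only [Function.iterate_succ_apply'] using R.transGen_f_self (T.g^[n] u)
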